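/- Suppose f : ℝ^d → ℝ is real-valued with f̂ ∈ L¹(ℝ^d), ‖f‖_{B^log} < ∞ and ‖f‖_{B⁰} > 0. For any m ∈ ℕ and any compact set Ω ⊂ ℝ^d with diam(Ω) > 0, there exists a ReLU network F : ℝ^d → ℝ of width d+4 and depth at most 6·C₁(Ω)·m·‖f‖_{B^log}/‖f‖_{B⁰}, where C₁(Ω) = log₂(2 + diam(Ω)), such that ‖f − F‖_{L²(Ω)} ≤ (2π²/√m)·|Ω|^{1/2}·‖f‖_{B⁰}. -/

import Mathlib

open MeasureTheory Real Filter

noncomputable section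

/-- The ℓ¹ norm on `ℝ^d`. -/
def l1 {d : ℕ} (ξ : Fin d → ℝ) : ℝ := ∑ i, |ξ i|

/-- The Fourier transform `f̂(ξ) = ∫ f(x) e^{-2πi ξ·x} dx`. -/
def fhat {d : ℕ} (f : (Fin d → ℝ) → ℂ) (ξ : Fin d → ℝ) : ℂ :=
  ∫ x : Fin d → ℝ,
    Complex.exp (-(2 * (Real.pi : ℂ) * Complex.I * ((∑ i, ξ i * x i : ℝ) : ℂ))) * f x

/-- Fourier transform of a real-valued function. -/
def fhatR {d : ℕ} (f : (Fin d → ℝ) → ℝ) : (Fin d → ℝ) → ℂ :=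
  fhat (fun x => (f x : ℂ))

/-- log-Barron norm `∫ log₂(2+‖ξ‖₁)|g(ξ)| dξ` of a frequency-side function `g`. -/
def logBarron {d : ℕ} (g : (Fin d → ℝ) → ℂ) : ℝ :=
  ∫ ξ : Fin d → ℝ, Real.logb 2 (2 + l1 ξ) * ‖g ξ‖

/-- Barron norm of order 0 : `∫ (1 + ‖ξ‖₁⁰)|g(ξ)| dξ = 2∫|g(ξ)|dξ`. -/
def B0 {d : ℕ} (g : (Fin d → ℝ) → ℂ) : ℝ := 2 * ∫ ξ : Fin d → ℝ, ‖g ξ‖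

/-- Barron norm of order 1 : `∫ (1 + ‖ξ‖₁)|g(ξ)| dξ`. -/
def B1 {d : ℕ} (g : (Fin d → ℝ) → ℂ) : ℝ := ∫ ξ : Fin d → ℝ, (1 + l1 ξ) * ‖g ξ‖

/-- first-order log-Barron norm `∫ (1+‖ξ‖₁) log₂(2+‖ξ‖₁)|g(ξ)| dξ`. -/
def B1log {d : ℕ} (g : (Fin d → ℝ) → ℂ) : ℝ :=
  ∫ ξ : Fin d → ℝ, (1 + l1 ξ) * Real.logb 2 (2 + l1 ξ) * ‖g ξ‖

/-- One hidden ReLU layer `z ↦ ReLU(Wz+b)`. -/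
def reluLayer {N : ℕ} (W : Matrix (Fin N) (Fin N) ℝ) (b : Fin N → ℝ) (z : Fin N → ℝ) :
    Fin N → ℝ :=
  fun i => max 0 (W.mulVec z i + b i)

/-- Iterate `k` hidden layers. -/
def hiddenIter {N : ℕ} (W : ℕ → Matrix (Fin N) (Fin N) ℝ) (b : ℕ → Fin N → ℝ) :
    ℕ → (Fin N → ℝ) → (Fin N → ℝ)
  | 0, z => z
  | k + 1, z => reluLayer (W k) (b k) (hiddenIter W b k z)

/-- `F : ℝ^d → ℝ` is a ReLU network of width `N` and depth `L`:
`F(x) = W_L z_{L-1}`, `z₀ = x`, `z_l = ReLU(W_l z_{l-1} + b_l)` for `1 ≤ l ≤ L-1`. -/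
def IsReLUNet (d N L : ℕ) (F : (Fin d → ℝ) → ℝ) : Prop :=
  ∃ (W₁ : Matrix (Fin N) (Fin d) ℝ) (b₁ : Fin N → ℝ)
    (W : ℕ → Matrix (Fin N) (Fin N) ℝ) (b : ℕ → Fin N → ℝ) (Wout : Fin N → ℝ),
    ∀ x, F x = ∑ i, Wout i *
      hiddenIter W b (L - 2) (fun j => max 0 (W₁.mulVec x j + b₁ j)) i

/-- `v` is the `j`-th weak partial derivative of `u` on `Ω`. -/
def HasWeakPartial {d : ℕ} (Ω : Set (Fin d → ℝ)) (u : (Fin d → ℝ) → ℝ) (j : Fin d)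
    (v : (Fin d → ℝ) → ℝ) : Prop :=
  ∀ φ : (Fin d → ℝ) → ℝ, ContDiff ℝ (⊤ : ℕ∞) φ → HasCompactSupport φ → tsupport φ ⊆ interior Ω →
    ∫ x in Ω, u x * fderiv ℝ φ x (Pi.single j 1) = - ∫ x in Ω, v x * φ x

/-- Euclidean diameter of a set in `ℝ^d`. -/
def eucDiam {d : ℕ} (Ω : Set (Fin d → ℝ)) : ℝ :=
  sSup {r : ℝ | ∃ x ∈ Ω, ∃ y ∈ Ω, r = Real.sqrt (∑ i, (x i - y i) ^ 2)}


open scoped FourierTransform SchwartzMap ContDiff in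
lemma aux_inv_ae {V : Type*} [NormedAddCommGroup V] [InnerProductSpace ℝ V] [FiniteDimensional ℝ V]
    [MeasurableSpace V] [BorelSpace V] {f : V → ℂ} (hf : Integrable f) (hF : Integrable (𝓕 f)) :
    ∀ᵐ x, 𝓕⁻ (𝓕 f) x = f x := by
  have sa : ∀ (u v : V → ℂ), Integrable u → Integrable v →
      ∫ x, 𝓕 u x * v x = ∫ x, u x * 𝓕 v x := by
    intro u v hu hv
    have := VectorFourier.integral_fourierIntegral_smul_eq_flip (μ := volume) (ν := volume)
      (L := innerₗ V) Real.continuous_fourierChar continuous_inner hu hv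
    simp only [flip_innerₗ] at this
    exact this
  have hcont : Continuous (𝓕⁻ (𝓕 f)) := by
    have h1 : Continuous (𝓕 (𝓕 f)) :=
      VectorFourier.fourierIntegral_continuous Real.continuous_fourierChar continuous_inner hF
    have : (𝓕⁻ (𝓕 f)) = fun x => 𝓕 (𝓕 f) (-x) := by
      ext x; exact Real.fourierInv_eq_fourier_neg _ _
    rw [this]; exact h1.comp continuous_neg
  refine ae_eq_of_integral_contDiff_smul_eq hcont.locallyIntegrable hf.locallyIntegrable ?_
  intro g gd gs
  have hcs : HasCompactSupport (fun x => (g x : ℂ)) := gs.comp_left (g := fun r : ℝ => (r : ℂ)) (by simp)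
  have hcd : ContDiff ℝ ∞ (fun x => (g x : ℂ)) := Complex.ofRealCLM.contDiff.comp gd
  let φ : 𝓢(V, ℂ) := hcs.toSchwartzMap hcd
  have hφ : ∀ x, φ x = (g x : ℂ) := fun x => rfl
  let ψ : 𝓢(V, ℂ) := 𝓕⁻ φ
  have h1 : 𝓕 ψ = φ := FourierTransform.fourier_fourierInv_eq φ
  have h1' : ∀ x, 𝓕 (ψ : V → ℂ) x = φ x := by
    intro x; rw [← SchwartzMap.fourier_coe, h1]
  have e1 : ∫ x, g x • f x = ∫ x, ψ x * 𝓕 f x := by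
    rw [← sa _ _ ψ.integrable hf]
    congr 1; ext x; rw [h1', hφ]; simp
  have e2 : ∫ x, g x • 𝓕⁻ (𝓕 f) x = ∫ x, ψ x * 𝓕 f x := by
    have a1 : ∫ x, g x • 𝓕⁻ (𝓕 f) x = ∫ x, φ (-x) * 𝓕 (𝓕 f) x := by
      rw [← integral_neg_eq_self]
      congr 1; ext x; rw [Real.fourierInv_eq_fourier_neg, hφ]; simp
    rw [a1, ← sa (fun x => φ (-x)) _ φ.integrable.comp_neg hF]
    congr 1; ext x
    congr 1
    rw [show ψ x = 𝓕⁻ (φ : V → ℂ) x by rw [← SchwartzMap.fourierInv_coe]]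
    rw [Real.fourierInv_eq_fourier_comp_neg]
  rw [e1, e2]

lemma aux_f_integrable {d : ℕ} (f : (Fin d → ℝ) → ℝ) (h : 0 < B0 (fhatR f)) : Integrable f := by
  by_contra hf
  have : fhatR f = fun _ => 0 := by
    ext ξ
    unfold fhatR fhat
    apply integral_undef
    intro hi
    apply hf
    have hm : Integrable (fun x : Fin d → ℝ => Complex.exp ((2 * (Real.pi : ℂ) * Complex.I * ((∑ i, ξ i * x i : ℝ) : ℂ))) * (Complex.exp (-(2 * (Real.pi : ℂ) * Complex.I * ((∑ i, ξ i * x i : ℝ) : ℂ))) * f x)) := by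
      refine hi.bdd_mul (c := 1) ?_ ?_
      · apply Continuous.aestronglyMeasurable; fun_prop
      · refine Eventually.of_forall fun x => ?_
        rw [Complex.norm_exp]; simp
    have h2 := hm.re
    refine h2.congr (Eventually.of_forall fun x => ?_)
    simp only [← mul_assoc, ← Complex.exp_add]
    simp
  rw [this] at h
  simp [B0] at h

open scoped FourierTransform in
lemma aux_inversion {d : ℕ} (f : (Fin d → ℝ) → ℝ) (hf : Integrable f)
    (hf1 : Integrable (fhatR f)) :
    ∀ᵐ x, f x = ∫ ξ : Fin d → ℝ,
      (fhatR f ξ * Complex.exp (2 * (Real.pi : ℂ) * Complex.I * ((∑ i, ξ i * x i : ℝ) : ℂ))).re := by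
  have mp := PiLp.volume_preserving_ofLp (Fin d)
  have mp' := PiLp.volume_preserving_toLp (Fin d)
  have me : MeasurableEmbedding (@WithLp.ofLp 2 (Fin d → ℝ)) :=
    (MeasurableEquiv.toLp 2 (Fin d → ℝ)).symm.measurableEmbedding
  have me' : MeasurableEmbedding (@WithLp.toLp 2 (Fin d → ℝ)) :=
    (MeasurableEquiv.toLp 2 (Fin d → ℝ)).measurableEmbedding
  let G : EuclideanSpace ℝ (Fin d) → ℂ := fun x => (f x.ofLp : ℂ)
  have hG : Integrable G := (mp.integrable_comp_emb me).2 hf.ofReal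
  have hFG : ∀ ξ, 𝓕 G ξ = fhatR f ξ.ofLp := by
    intro ξ
    rw [Real.fourier_eq']
    unfold fhatR fhat
    rw [← mp.integral_comp me]
    congr 1; ext x
    rw [smul_eq_mul]
    congr 2
    simp [PiLp.inner_apply]
    ring
  have hFi : Integrable (𝓕 G) := by
    rw [show 𝓕 G = fhatR f ∘ WithLp.ofLp from funext hFG]
    exact (mp.integrable_comp_emb me).2 hf1
  have := aux_inv_ae hG hFi
  have h2 := mp'.quasiMeasurePreserving.ae this
  filter_upwards [h2] with x hx
  rw [Real.fourierInv_eq'] at hx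
  have h3 : (∫ ξ : Fin d → ℝ,
      (fhatR f ξ * Complex.exp (2 * (Real.pi : ℂ) * Complex.I * ((∑ i, ξ i * x i : ℝ) : ℂ)))) = (f x : ℂ) := by
    rw [← mp.integral_comp me]
    refine Eq.trans ?_ hx
    congr 1; ext ξ
    rw [smul_eq_mul, hFG, mul_comm]
    congr 2
    simp [PiLp.inner_apply]
    rw [mul_right_comm]
    simp only [mul_comm]
  have h4 : Integrable (fun ξ : Fin d → ℝ =>
      (fhatR f ξ * Complex.exp (2 * (Real.pi : ℂ) * Complex.I * ((∑ i, ξ i * x i : ℝ) : ℂ)))) := by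
    refine hf1.mul_bdd (c := 1) ?_ ?_
    · apply Continuous.aestronglyMeasurable; fun_prop
    · refine Eventually.of_forall fun x => ?_
      rw [Complex.norm_exp]; simp
  have h5 := integral_re h4
  simp only [RCLike.re_to_complex] at h5
  rw [h5, h3]; simp

/-- 1-periodic hat wave. -/
def hat (t : ℝ) : ℝ := 2 * min (Int.fract t) (1 - Int.fract t)

lemma hat_nonneg (t : ℝ) : 0 ≤ hat t := by
  have := Int.fract_nonneg t; have := (Int.fract_lt_one t).le
  unfold hat
  have : 0 ≤ min (Int.fract t) (1 - Int.fract t) := le_min (by linarith) (by linarith)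
  linarith

lemma hat_le_one (t : ℝ) : hat t ≤ 1 := by
  unfold hat
  have h1 := min_le_left (Int.fract t) (1 - Int.fract t)
  have h2 := min_le_right (Int.fract t) (1 - Int.fract t)
  linarith

lemma hat_add_int (t : ℝ) (n : ℤ) : hat (t + n) = hat t := by simp [hat]

lemma hat_sub_int (t : ℝ) (n : ℤ) : hat (t - n) = hat t := by simp [hat]

lemma hat_of_mem {v : ℝ} (h0 : 0 ≤ v) (h1 : v ≤ 1) : hat v = 2 * min v (1 - v) := by
  rcases h1.lt_or_eq with h | h
  · have : Int.fract v = v := Int.fract_eq_self.2 ⟨h0, h⟩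
    simp [hat, this]
  · subst h; simp [hat]

lemma hat_relu {v : ℝ} (h0 : 0 ≤ v) (h1 : v ≤ 1) :
    2 * max 0 v - 4 * max 0 (v - 1 / 2) = hat v := by
  rw [hat_of_mem h0 h1]
  rcases le_total v (1/2) with h | h
  · rw [max_eq_right h0, max_eq_left (by linarith), min_eq_left (by linarith)]; ring
  · rw [max_eq_right h0, max_eq_right (by linarith), min_eq_right (by linarith)]; ring

lemma hat_hat (t : ℝ) : hat (hat t) = hat (2 * t) := by
  have h0 := Int.fract_nonneg t
  have h1 := (Int.fract_lt_one t).le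
  have e : hat (2 * t) = hat (2 * Int.fract t) := by
    rw [← hat_sub_int (2 * t) (2 * ⌊t⌋)]
    congr 1; push_cast; rw [← Int.self_sub_floor]; ring
  rw [e]
  set u := Int.fract t with hu
  rcases le_total u (1/2) with h | h
  · have : hat t = 2 * u := by unfold hat; rw [← hu, min_eq_left (by linarith)]
    rw [this]
  · have : hat t = 2 - 2 * u := by unfold hat; rw [← hu, min_eq_right (by linarith)]; ring
    rw [this, hat_of_mem (by linarith) (by linarith)]
    have e2 := hat_sub_int (2 * u) 1
    rw [← e2, hat_of_mem (by push_cast; linarith) (by push_cast; linarith), min_comm]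
    push_cast
    congr 2 <;> ring

lemma hat_measurable : Measurable hat := by
  unfold hat
  exact ((measurable_fract.min (measurable_const.sub measurable_fract))).const_mul 2

lemma hat_coeff : ∫ s in (0:ℝ)..1, (hat s : ℂ) * Complex.exp (-(2 * Real.pi * Complex.I * s)) =
    -(2 / Real.pi ^ 2) := by
  set c : ℂ := -(2 * Real.pi * Complex.I) with hc
  have hc0 : c ≠ 0 := by simp [hc, Real.pi_ne_zero]
  have hce : ∀ s : ℝ, Complex.exp (-(2 * Real.pi * Complex.I * s)) = Complex.exp (c * s) := by
    intro s; congr 1; rw [hc]; ring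
  have hD : ∀ s : ℝ, HasDerivAt (fun s : ℝ => Complex.exp (c * s)) (c * Complex.exp (c * s)) s := by
    intro s
    have h1 : HasDerivAt (fun s : ℝ => c * (s : ℂ)) (c * 1) s :=
      (Complex.ofRealCLM.hasDerivAt (x := s)).const_mul c
    convert h1.cexp using 1; ring
  have hid : ∀ s : ℝ, HasDerivAt (fun s : ℝ => (s : ℂ)) 1 s := fun s =>
    Complex.ofRealCLM.hasDerivAt (x := s)
  have E1 : Complex.exp c = 1 := by
    rw [hc, Complex.exp_neg, Complex.exp_two_pi_mul_I]; simp
  have E2 : Complex.exp (c * (1/2 : ℝ)) = -1 := by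
    rw [hc, show -(2 * (Real.pi : ℂ) * Complex.I) * ((1/2 : ℝ) : ℂ) = -(Real.pi * Complex.I) by push_cast; ring,
      Complex.exp_neg, Complex.exp_pi_mul_I]; norm_num
  have I1 : ∫ s in (0:ℝ)..(1/2), (2 * (s:ℂ)) * Complex.exp (c * s) =
      (2 * (((1/2:ℝ):ℂ) / c - 1 / c^2)) * Complex.exp (c * (1/2:ℝ)) - (2 * (((0:ℝ):ℂ) / c - 1 / c^2)) * Complex.exp (c * (0:ℝ)) := by
    refine intervalIntegral.integral_eq_sub_of_hasDerivAt (f := fun s : ℝ => (2 * ((s:ℂ) / c - 1 / c^2)) * Complex.exp (c * s)) ?_ ?_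
    · intro s _
      refine (((((hid s).div_const c).sub_const (1 / c^2)).const_mul 2).mul (hD s)).congr_deriv ?_
      field_simp; ring
    · apply Continuous.intervalIntegrable; fun_prop
  have I2 : ∫ s in (1/2:ℝ)..1, (2 - 2 * (s:ℂ)) * Complex.exp (c * s) =
      ((2 - 2 * ((1:ℝ):ℂ)) / c + 2 / c^2) * Complex.exp (c * (1:ℝ)) - ((2 - 2 * ((1/2:ℝ):ℂ)) / c + 2 / c^2) * Complex.exp (c * (1/2:ℝ)) := by
    refine intervalIntegral.integral_eq_sub_of_hasDerivAt (f := fun s : ℝ => ((2 - 2 * (s:ℂ)) / c + 2 / c^2) * Complex.exp (c * s)) ?_ ?_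
    · intro s _
      refine ((((((hid s).const_mul 2).const_sub 2).div_const c).add_const (2 / c^2)).mul (hD s)).congr_deriv ?_
      field_simp; ring
    · apply Continuous.intervalIntegrable; fun_prop
  have J1 : ∫ s in (0:ℝ)..(1/2), (hat s : ℂ) * Complex.exp (c * s) = ∫ s in (0:ℝ)..(1/2), (2 * (s:ℂ)) * Complex.exp (c * s) := by
    apply intervalIntegral.integral_congr
    intro s hs
    rw [Set.uIcc_of_le (by norm_num)] at hs
    have : hat s = 2 * s := by
      rw [hat_of_mem hs.1 (by linarith [hs.2]), min_eq_left (by linarith [hs.2])]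
    simp only [this]; push_cast; ring
  have J2 : ∫ s in (1/2:ℝ)..1, (hat s : ℂ) * Complex.exp (c * s) = ∫ s in (1/2:ℝ)..1, (2 - 2 * (s:ℂ)) * Complex.exp (c * s) := by
    apply intervalIntegral.integral_congr
    intro s hs
    rw [Set.uIcc_of_le (by norm_num)] at hs
    have : hat s = 2 - 2 * s := by
      rw [hat_of_mem (by linarith [hs.1]) (by linarith [hs.2]), min_eq_right (by linarith [hs.1])]; ring
    simp only [this]; push_cast; ring
  have hint : ∀ a b : ℝ, IntervalIntegrable (fun s : ℝ => (hat s : ℂ) * Complex.exp (c * s)) volume a b := by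
    intro a b
    have : IntervalIntegrable (fun s : ℝ => Complex.exp (c * s)) volume a b := by
      apply Continuous.intervalIntegrable; fun_prop
    rw [intervalIntegrable_iff] at this ⊢
    refine this.bdd_mul (c := 1) ?_ ?_
    · exact (Complex.measurable_ofReal.comp hat_measurable).aestronglyMeasurable
    · refine Eventually.of_forall fun x => ?_
      rw [Complex.norm_real, Real.norm_eq_abs, abs_of_nonneg (hat_nonneg x)]; exact hat_le_one x
  simp only [hce]
  rw [← intervalIntegral.integral_add_adjacent_intervals (hint 0 (1/2)) (hint (1/2) 1), J1, J2, I1, I2, E2]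
  simp only [Complex.ofReal_one, mul_one, E1, Complex.ofReal_zero, mul_zero, Complex.exp_zero]
  have hc2 : c ^ 2 = -(4 * (Real.pi:ℂ) ^ 2) := by
    rw [hc]; ring_nf; rw [Complex.I_sq]; ring
  have : (Real.pi : ℂ) ≠ 0 := by exact_mod_cast Real.pi_ne_zero
  have h8 : (8 : ℂ) / c ^ 2 = -(2 / Real.pi ^ 2) := by
    rw [hc2]; field_simp; norm_num
  rw [← h8]
  push_cast
  ring

lemma hat_conv (t : ℝ) : ∫ s in (0:ℝ)..1, (hat (t - s) : ℂ) * Complex.exp (2 * Real.pi * Complex.I * s) =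
    -(2 / Real.pi ^ 2) * Complex.exp (2 * Real.pi * Complex.I * t) := by
  have h1 : ∀ s : ℝ, (hat (t - s) : ℂ) * Complex.exp (2 * Real.pi * Complex.I * s) =
    (fun u : ℝ => Complex.exp (2 * Real.pi * Complex.I * t) * ((hat u : ℂ) * Complex.exp (-(2 * Real.pi * Complex.I * u)))) (t - s) := by
    intro s
    simp only
    rw [mul_left_comm, ← Complex.exp_add]
    congr 2; push_cast; ring
  simp only [h1]
  rw [intervalIntegral.integral_comp_sub_left (fun u : ℝ => Complex.exp (2 * Real.pi * Complex.I * t) * ((hat u : ℂ) * Complex.exp (-(2 * Real.pi * Complex.I * u))))]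
  rw [intervalIntegral.integral_const_mul]
  have hp : Function.Periodic (fun u : ℝ => (hat u : ℂ) * Complex.exp (-(2 * Real.pi * Complex.I * u))) 1 := by
    intro u
    have : hat (u + 1) = hat u := by simpa using hat_add_int u 1
    simp only [this]
    congr 1
    rw [show -(2 * (Real.pi:ℂ) * Complex.I * ((u + 1 : ℝ) : ℂ)) = -(2 * Real.pi * Complex.I * u) - 2 * Real.pi * Complex.I by push_cast; ring,
      Complex.exp_sub, Complex.exp_two_pi_mul_I, div_one]
  have h2 := hp.intervalIntegral_add_eq (t - 1) 0
  rw [show t - 1 + 1 = t - 0 by ring, zero_add, hat_coeff] at h2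
  rw [h2]; ring

lemma maurey_step {Θ X : Type*} [MeasurableSpace Θ] [MeasurableSpace X] (P : Measure Θ)
    [IsProbabilityMeasure P] (μ : Measure X) [IsFiniteMeasure μ] (g : Θ → X → ℝ)
    (hg : Measurable (Function.uncurry g)) (A : ℝ) (hA : ∀ θ x, |g θ x| ≤ A)
    (c : Θ → ℝ) (hc : Integrable c P) (S : X → ℝ) (hS : Measurable S) (M : ℝ)
    (hM : ∀ x, |S x| ≤ M) :
    ∃ θ, ∫ x, (S x + (g θ x - ∫ θ', g θ' x ∂P)) ^ 2 ∂μ + c θ ≤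
      ∫ x, S x ^ 2 ∂μ + (A ^ 2 * μ.real Set.univ + ∫ θ, c θ ∂P) := by
  set F : X → ℝ := fun x => ∫ θ', g θ' x ∂P with hF
  have hFm : Measurable F := by
    have : StronglyMeasurable F := by
      apply StronglyMeasurable.integral_prod_left
      exact hg.stronglyMeasurable
    exact this.measurable
  have hgi : ∀ x, Integrable (fun θ => g θ x) P := fun x =>
    Integrable.of_bound (hg.comp (measurable_id.prodMk measurable_const)).aestronglyMeasurable A
      (Eventually.of_forall fun θ => hA θ x)
  have hg2i : ∀ x, Integrable (fun θ => g θ x ^ 2) P := fun x =>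
    Integrable.of_bound ((hg.comp (measurable_id.prodMk measurable_const)).pow_const 2).aestronglyMeasurable (A ^ 2)
      (Eventually.of_forall fun θ => by
        rw [Real.norm_eq_abs, abs_pow]; exact pow_le_pow_left₀ (abs_nonneg _) (hA θ x) 2)
  have hFb : ∀ x, |F x| ≤ A := by
    intro x
    have := norm_integral_le_of_norm_le_const (μ := P) (f := fun θ => g θ x) (C := A)
      (Eventually.of_forall fun θ => hA θ x)
    simpa using this
  have hJm : Measurable (fun p : Θ × X => (S p.2 + (g p.1 p.2 - F p.2)) ^ 2) :=
    ((hS.comp measurable_snd).add (hg.sub (hFm.comp measurable_snd))).pow_const 2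
  have hJ : Integrable (fun p : Θ × X => (S p.2 + (g p.1 p.2 - F p.2)) ^ 2) (P.prod μ) := by
    refine Integrable.of_bound hJm.aestronglyMeasurable ((M + (A + A)) ^ 2)
      (Eventually.of_forall fun p => ?_)
    rw [Real.norm_eq_abs, abs_pow]
    refine pow_le_pow_left₀ (abs_nonneg _) ?_ 2
    refine (abs_add_le _ _).trans (add_le_add (hM _) ?_)
    exact (abs_sub _ _).trans (add_le_add (hA _ _) (hFb _))
  have hH := hJ.integral_prod_left
  obtain ⟨θ, hθ⟩ := exists_le_integral (hH.add hc)
  refine ⟨θ, hθ.trans ?_⟩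
  simp only [Pi.add_apply]
  rw [integral_add hH hc, ← add_assoc]
  refine add_le_add ?_ le_rfl
  have sw := integral_integral_swap (f := fun θ x => (S x + (g θ x - F x)) ^ 2) hJ
  rw [sw]
  have hS2 : Integrable (fun x => S x ^ 2) μ := by
    refine Integrable.of_bound (hS.pow_const 2).aestronglyMeasurable (M ^ 2)
      (Eventually.of_forall fun x => ?_)
    rw [Real.norm_eq_abs, abs_pow]
    exact pow_le_pow_left₀ (abs_nonneg _) (hM x) 2
  have : ∫ x, S x ^ 2 ∂μ + A ^ 2 * μ.real Set.univ = ∫ x, (S x ^ 2 + A ^ 2) ∂μ := by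
    rw [integral_add hS2 (integrable_const _)]; simp [mul_comm]
  rw [this]
  refine integral_mono hJ.integral_prod_right (hS2.add (integrable_const _)) fun x => ?_
  have e : ∀ θ, (S x + (g θ x - F x)) ^ 2 = ((S x - F x) ^ 2 + (2 * (S x - F x)) * g θ x) + g θ x ^ 2 := by
    intro θ; ring
  simp only [e]
  have i1 : Integrable (fun θ => (S x - F x) ^ 2 + (2 * (S x - F x)) * g θ x) P :=
    (integrable_const _).add ((hgi x).const_mul _)
  rw [integral_add i1 (hg2i x),
    integral_add (integrable_const _) ((hgi x).const_mul _), integral_const_mul]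
  have h2 : ∫ θ, g θ x ^ 2 ∂P ≤ A ^ 2 := by
    have := integral_mono (μ := P) (hg2i x) (integrable_const (A ^ 2)) (fun θ => by
      simp only
      rw [← sq_abs]; exact pow_le_pow_left₀ (abs_nonneg _) (hA θ x) 2)
    simpa using this
  have h3 : ∫ θ, g θ x ∂P = F x := rfl
  rw [h3]
  simp
  nlinarith [sq_nonneg (F x)]

lemma maurey {Θ X : Type*} [MeasurableSpace Θ] [MeasurableSpace X] (P : Measure Θ)
    [IsProbabilityMeasure P] (μ : Measure X) [IsFiniteMeasure μ] (g : Θ → X → ℝ)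
    (hg : Measurable (Function.uncurry g)) (A : ℝ) (hA : ∀ θ x, |g θ x| ≤ A)
    (c : Θ → ℝ) (hc : Integrable c P) (n : ℕ) :
    ∃ θ : Fin n → Θ, ∫ x, (∑ i, (g (θ i) x - ∫ θ', g θ' x ∂P)) ^ 2 ∂μ + ∑ i, c (θ i) ≤
      n * (A ^ 2 * μ.real Set.univ + ∫ θ, c θ ∂P) := by
  induction n with
  | zero => exact ⟨Fin.elim0, by simp⟩
  | succ n ih =>
    obtain ⟨θ, hθ⟩ := ih
    have hFm : Measurable (fun x => ∫ θ', g θ' x ∂P) := by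
      have : StronglyMeasurable (fun x => ∫ θ', g θ' x ∂P) := by
        apply StronglyMeasurable.integral_prod_left
        exact hg.stronglyMeasurable
      exact this.measurable
    have hFb : ∀ x, |∫ θ', g θ' x ∂P| ≤ A := by
      intro x
      have := norm_integral_le_of_norm_le_const (μ := P) (f := fun θ => g θ x) (C := A)
        (Eventually.of_forall fun θ => hA θ x)
      simpa using this
    obtain ⟨t, ht⟩ := maurey_step P μ g hg A hA c hc
      (fun x => ∑ i, (g (θ i) x - ∫ θ', g θ' x ∂P))
      (Finset.measurable_fun_sum _ fun i _ => (hg.comp (measurable_const.prodMk measurable_id)).sub hFm)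
      (∑ i : Fin n, (A + A))
      (fun x => (Finset.abs_sum_le_sum_abs _ _).trans (Finset.sum_le_sum fun i _ =>
        (abs_sub _ _).trans (add_le_add (hA _ _) (hFb _))))
    refine ⟨Fin.snoc θ t, ?_⟩
    simp only [Fin.sum_univ_castSucc, Fin.snoc_castSucc, Fin.snoc_last]
    push_cast
    linarith

inductive ANet (d N : ℕ) : ℕ → ((Fin d → ℝ) → Fin N → ℝ) → Prop
  | first (A : (Fin d → ℝ) →ₗ[ℝ] (Fin N → ℝ)) (b : Fin N → ℝ) :
      ANet d N 0 (fun x j => max 0 (A x j + b j))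
  | step (k : ℕ) (Φ : (Fin d → ℝ) → Fin N → ℝ) (A : (Fin N → ℝ) →ₗ[ℝ] (Fin N → ℝ))
      (b : Fin N → ℝ) (h : ANet d N k Φ) :
      ANet d N (k + 1) (fun x j => max 0 (A (Φ x) j + b j))

lemma ANet.nonneg {d N k : ℕ} {Φ : (Fin d → ℝ) → Fin N → ℝ} (h : ANet d N k Φ) (x : Fin d → ℝ)
    (j : Fin N) : 0 ≤ Φ x j := by
  cases h <;> exact le_max_left _ _

lemma hiddenIter_congr {N : ℕ} {W W' : ℕ → Matrix (Fin N) (Fin N) ℝ} {b b' : ℕ → Fin N → ℝ}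
    (k : ℕ) (hW : ∀ i < k, W i = W' i) (hb : ∀ i < k, b i = b' i) (z : Fin N → ℝ) :
    hiddenIter W b k z = hiddenIter W' b' k z := by
  induction k with
  | zero => rfl
  | succ k ih =>
    simp only [hiddenIter]
    rw [ih (fun i hi => hW i (by omega)) (fun i hi => hb i (by omega)), hW k (by omega), hb k (by omega)]

lemma ANet.exists_iter {d N k : ℕ} {Φ : (Fin d → ℝ) → Fin N → ℝ} (h : ANet d N k Φ) :
    ∃ (W₁ : Matrix (Fin N) (Fin d) ℝ) (b₁ : Fin N → ℝ)
      (W : ℕ → Matrix (Fin N) (Fin N) ℝ) (b : ℕ → Fin N → ℝ),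
      ∀ x, hiddenIter W b k (fun j => max 0 (W₁.mulVec x j + b₁ j)) = Φ x := by
  induction h with
  | first A b =>
    refine ⟨LinearMap.toMatrix' A, b, fun _ => 0, fun _ => 0, fun x => ?_⟩
    simp [hiddenIter]
  | step k Φ A b h ih =>
    obtain ⟨W₁, b₁, W, b', hx⟩ := ih
    refine ⟨W₁, b₁, Function.update W k (LinearMap.toMatrix' A), Function.update b' k b, fun x => ?_⟩
    simp only [hiddenIter]
    rw [hiddenIter_congr (W' := W) (b' := b') k
      (fun i hi => Function.update_of_ne hi.ne _ _) (fun i hi => Function.update_of_ne hi.ne _ _), hx]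
    ext j
    simp [reluLayer]

def Good {d : ℕ} (B : ℝ) (Ω : Set (Fin d → ℝ)) (S v : (Fin d → ℝ) → ℝ) (k : ℕ) : Prop :=
  ∃ (Φ : (Fin d → ℝ) → Fin (d + 4) → ℝ) (C : ℝ), ANet d (d + 4) k Φ ∧ ∀ x ∈ Ω,
    (∀ i, Φ x (Fin.castAdd 4 i) = x i + B) ∧
    2 * Φ x (Fin.natAdd d 0) - 4 * Φ x (Fin.natAdd d 1) = v x ∧
    Φ x (Fin.natAdd d 2) = S x + C ∧ Φ x (Fin.natAdd d 3) = 1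

lemma Good.init {d : ℕ} (B : ℝ) (Ω : Set (Fin d → ℝ)) (hB : ∀ x ∈ Ω, ∀ i, 0 ≤ x i + B) :
    Good B Ω (fun _ => 0) (fun _ => 0) 0 := by
  refine ⟨_, 0, ANet.first (LinearMap.pi (Fin.addCases (fun i => LinearMap.proj i) ![0, 0, 0, 0]))
    (Fin.addCases (fun _ => B) ![0, 0, 0, 1]), fun x hx => ⟨fun i => ?_, ?_, ?_, ?_⟩⟩
  · simp [hB x hx i]
  · simp
  · simp
  · simp

lemma Good.layer {d : ℕ} {B : ℝ} {Ω : Set (Fin d → ℝ)} {S v : (Fin d → ℝ) → ℝ} {k : ℕ}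
    (hB : ∀ x ∈ Ω, ∀ i, 0 ≤ x i + B) (h : Good B Ω S v k) (hv : ∀ x ∈ Ω, |v x| ≤ 1)
    (ξ : Fin d → ℝ) (κ β a : ℝ) :
    Good B Ω (fun x => S x + a * v x)
      (fun x => 2 * max 0 (∑ i, ξ i * x i + κ * v x + β)
        - 4 * max 0 (∑ i, ξ i * x i + κ * v x + β - 1 / 2)) (k + 1) := by
  obtain ⟨Φ, C, hN, hΦ⟩ := h
  let pv : (Fin (d + 4) → ℝ) →ₗ[ℝ] ℝ :=
    (2 : ℝ) • LinearMap.proj (Fin.natAdd d 0) - (4 : ℝ) • LinearMap.proj (Fin.natAdd d 1)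
  let px : (Fin (d + 4) → ℝ) →ₗ[ℝ] ℝ := ∑ i, ξ i • LinearMap.proj (Fin.castAdd 4 i)
  let p : (Fin (d + 4) → ℝ) →ₗ[ℝ] ℝ := px + κ • pv
  let q : (Fin (d + 4) → ℝ) →ₗ[ℝ] ℝ := LinearMap.proj (Fin.natAdd d 2) + a • pv
  have hpv : ∀ x ∈ Ω, pv (Φ x) = v x := by
    intro x hx
    rw [← (hΦ x hx).2.1]; simp [pv]
  have hpx : ∀ x ∈ Ω, px (Φ x) = ∑ i, ξ i * x i + (∑ i, ξ i) * B := by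
    intro x hx
    simp only [px, LinearMap.sum_apply, LinearMap.smul_apply, LinearMap.proj_apply, (hΦ x hx).1,
      smul_eq_mul, mul_add, Finset.sum_add_distrib, Finset.sum_mul]
  have hp : ∀ x ∈ Ω, p (Φ x) + (β - (∑ i, ξ i) * B) = ∑ i, ξ i * x i + κ * v x + β := by
    intro x hx
    simp only [p, LinearMap.add_apply, LinearMap.smul_apply, hpv x hx, hpx x hx, smul_eq_mul]
    ring
  have hq : ∀ x ∈ Ω, q (Φ x) + |a| = S x + a * v x + (C + |a|) := by
    intro x hx
    simp only [q, LinearMap.add_apply, LinearMap.smul_apply, hpv x hx, (hΦ x hx).2.2.1, smul_eq_mul,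
      LinearMap.proj_apply]
    ring
  refine ⟨_, C + |a|, ANet.step k Φ (LinearMap.pi (Fin.addCases
      (fun i => LinearMap.proj (Fin.castAdd 4 i)) ![p, p, q, 0]))
    (Fin.addCases (fun _ => 0) ![β - (∑ i, ξ i) * B, β - (∑ i, ξ i) * B - 1 / 2, |a|, 1]) hN,
    fun x hx => ⟨fun i => ?_, ?_, ?_, ?_⟩⟩
  · simp only [LinearMap.pi_apply, Fin.addCases_left, LinearMap.proj_apply, add_zero, (hΦ x hx).1]
    exact max_eq_right (hB x hx i)
  · simp only [LinearMap.pi_apply, Fin.addCases_right]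
    have e := hp x hx
    simp only [Matrix.cons_val_zero, Matrix.cons_val_one]
    rw [← e]
    congr 3
    ring
  · simp only [LinearMap.pi_apply, Fin.addCases_right]
    have e := hq x hx
    simp only [Matrix.cons_val]
    rw [e]
    apply max_eq_right
    have h0 := hN.nonneg x (Fin.natAdd d 2)
    rw [(hΦ x hx).2.2.1] at h0
    have h1 : |a * v x| ≤ |a| := by
      rw [abs_mul]; exact mul_le_of_le_one_right (abs_nonneg _) (hv x hx)
    have := neg_abs_le (a * v x)
    linarith
  · simp

lemma Good.congr {d : ℕ} {B : ℝ} {Ω : Set (Fin d → ℝ)} {S v S' v' : (Fin d → ℝ) → ℝ} {k : ℕ}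
    (h : Good B Ω S v k) (hS : ∀ x ∈ Ω, S x = S' x) (hv : ∀ x ∈ Ω, v x = v' x) :
    Good B Ω S' v' k := by
  obtain ⟨Φ, C, hN, hΦ⟩ := h
  refine ⟨Φ, C, hN, fun x hx => ?_⟩
  rw [← hS x hx, ← hv x hx]; exact hΦ x hx

lemma Good.isReLUNet {d : ℕ} {B : ℝ} {Ω : Set (Fin d → ℝ)} {S v : (Fin d → ℝ) → ℝ} {k : ℕ}
    (h : Good B Ω S v k) (r : ℝ) : ∃ F, IsReLUNet d (d + 4) (k + 2) F ∧ ∀ x ∈ Ω, F x = r * S x := by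
  obtain ⟨Φ, C, hN, hΦ⟩ := h
  obtain ⟨W₁, b₁, W, b, hx⟩ := hN.exists_iter
  refine ⟨fun x => ∑ i, (Pi.single (Fin.natAdd d 2) r + Pi.single (Fin.natAdd d 3) (-(r * C)) : Fin (d + 4) → ℝ) i * Φ x i,
    ⟨W₁, b₁, W, b, Pi.single (Fin.natAdd d 2) r + Pi.single (Fin.natAdd d 3) (-(r * C)), fun x => ?_⟩, fun x hx => ?_⟩
  · simp only [Nat.add_sub_cancel, hx]
  · simp only [Pi.add_apply, add_mul, Finset.sum_add_distrib, Pi.single_apply, ite_mul, zero_mul,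
      Finset.sum_ite_eq', Finset.mem_univ, if_true]
    rw [(hΦ x hx).2.2.1, (hΦ x hx).2.2.2]; ring

lemma Good.term {d : ℕ} {B : ℝ} {Ω : Set (Fin d → ℝ)} {S : (Fin d → ℝ) → ℝ} {k : ℕ}
    (hB : ∀ x ∈ Ω, ∀ i, 0 ≤ x i + B) (h : Good B Ω S (fun _ => 0) k)
    (ξ : Fin d → ℝ) (s a : ℝ) (K : ℕ) (c : ℤ)
    (hK : ∀ x ∈ Ω, 0 ≤ ∑ i, ξ i * x i - s - c ∧ ∑ i, ξ i * x i - s - c ≤ 2 ^ K) :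
    Good B Ω (fun x => S x + a * hat (∑ i, ξ i * x i - s)) (fun _ => 0) (k + (K + 2)) := by
  have habs : ∀ t, |hat t| ≤ 1 := fun t => by
    rw [abs_of_nonneg (hat_nonneg t)]; exact hat_le_one t
  set w : (Fin d → ℝ) → ℝ := fun x => (∑ i, ξ i * x i - s - c) / 2 ^ K with hw
  have h2 : (0 : ℝ) < 2 ^ K := by positivity
  have hj : ∀ j : ℕ, Good B Ω S (fun x => hat (2 ^ j * w x)) (k + 1 + j) := by
    intro j
    induction j with
    | zero =>
      refine (h.layer hB (by simp) (fun i => ξ i / 2 ^ K) 0 (-(s + c) / 2 ^ K) 0).congr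
        (by simp) (fun x hx => ?_)
      have e : ∑ i, ξ i / 2 ^ K * x i + 0 * 0 + -(s + c) / 2 ^ K = w x := by
        have : ∑ i, ξ i / 2 ^ K * x i = (∑ i, ξ i * x i) / 2 ^ K := by
          rw [Finset.sum_div]; congr 1; ext i; ring
        rw [this, hw]; ring
      simp only [e, pow_zero, one_mul]
      exact hat_relu (div_nonneg (hK x hx).1 h2.le) ((div_le_one h2).2 (hK x hx).2)
    | succ j ih =>
      refine (ih.layer hB (fun x _ => habs _) 0 1 0 0).congr (by simp) (fun x hx => ?_)
      simp only [Pi.zero_apply, zero_mul, Finset.sum_const_zero, zero_add, one_mul, add_zero]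
      rw [hat_relu (hat_nonneg _) (hat_le_one _), hat_hat]
      congr 1; ring
  have h3 := (hj K).layer hB (fun x _ => habs _) 0 0 0 a
  rw [show k + (K + 2) = k + 1 + K + 1 by ring]
  refine h3.congr (fun x hx => ?_) (fun x hx => ?_)
  · have : 2 ^ K * w x = ∑ i, ξ i * x i - s - c := by rw [hw]; field_simp
    rw [this, hat_sub_int]
  · simp

lemma Good.sum {d : ℕ} {B : ℝ} {Ω : Set (Fin d → ℝ)}
    (hB : ∀ x ∈ Ω, ∀ i, 0 ≤ x i + B) (n : ℕ) (ξ : Fin n → Fin d → ℝ) (s a : Fin n → ℝ)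
    (K : Fin n → ℕ) (c : Fin n → ℤ)
    (hK : ∀ j, ∀ x ∈ Ω, 0 ≤ ∑ i, ξ j i * x i - s j - c j ∧ ∑ i, ξ j i * x i - s j - c j ≤ 2 ^ (K j)) :
    Good B Ω (fun x => ∑ j, a j * hat (∑ i, ξ j i * x i - s j)) (fun _ => 0) (∑ j, (K j + 2)) := by
  induction n with
  | zero => simpa using Good.init B Ω hB
  | succ n ih =>
    have h1 := ih (fun j => ξ j.castSucc) (fun j => s j.castSucc) (fun j => a j.castSucc)
      (fun j => K j.castSucc) (fun j => c j.castSucc) (fun j => hK j.castSucc)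
    have h2 := h1.term hB (ξ (Fin.last n)) (s (Fin.last n)) (a (Fin.last n)) (K (Fin.last n))
      (c (Fin.last n)) (hK (Fin.last n))
    simp only [Fin.sum_univ_castSucc]
    exact h2

lemma aux_coord {d : ℕ} {Ω : Set (Fin d → ℝ)} (hdiam : 0 < eucDiam Ω) {x y : Fin d → ℝ}
    (hx : x ∈ Ω) (hy : y ∈ Ω) (i : Fin d) : |x i - y i| ≤ eucDiam Ω := by
  have hb : BddAbove {r : ℝ | ∃ x ∈ Ω, ∃ y ∈ Ω, r = Real.sqrt (∑ i, (x i - y i) ^ 2)} := by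
    by_contra h
    unfold eucDiam at hdiam
    rw [Real.sSup_of_not_bddAbove h] at hdiam
    exact lt_irrefl _ hdiam
  have h1 : Real.sqrt (∑ i, (x i - y i) ^ 2) ≤ eucDiam Ω := le_csSup hb ⟨x, hx, y, hy, rfl⟩
  refine le_trans ?_ h1
  apply Real.abs_le_sqrt
  exact Finset.single_le_sum (f := fun i => (x i - y i) ^ 2) (fun i _ => sq_nonneg _) (Finset.mem_univ i)

lemma one_le_logb {r : ℝ} (hr : 0 ≤ r) : 1 ≤ Real.logb 2 (2 + r) := by
  rw [Real.le_logb_iff_rpow_le (by norm_num) (by linarith)]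
  norm_num; exact hr

lemma aux_K {d : ℕ} {Ω : Set (Fin d → ℝ)} (hdiam : 0 < eucDiam Ω) (ξ : Fin d → ℝ) (s : ℝ) :
    ∃ (K : ℕ) (c : ℤ), (∀ x ∈ Ω, 0 ≤ ∑ i, ξ i * x i - s - c ∧ ∑ i, ξ i * x i - s - c ≤ 2 ^ K) ∧
      ((K + 2 : ℕ) : ℝ) ≤ 6 * Real.logb 2 (2 + eucDiam Ω) * Real.logb 2 (2 + l1 ξ) := by
  rcases Ω.eq_empty_or_nonempty with rfl | ⟨x0, hx0⟩
  · simp [eucDiam] at hdiam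
  set D := eucDiam Ω
  set r := l1 ξ with hr
  have hr0 : 0 ≤ r := Finset.sum_nonneg fun i _ => abs_nonneg _
  have hdiff : ∀ x ∈ Ω, |∑ i, ξ i * x i - ∑ i, ξ i * x0 i| ≤ r * D := by
    intro x hx
    rw [← Finset.sum_sub_distrib, hr, l1, Finset.sum_mul]
    refine (Finset.abs_sum_le_sum_abs _ _).trans (Finset.sum_le_sum fun i _ => ?_)
    rw [← mul_sub, abs_mul]
    exact mul_le_mul_of_nonneg_left (aux_coord hdiam hx hx0 i) (abs_nonneg _)
  set a := Real.logb 2 (2 + r)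
  set b := Real.logb 2 (2 + D)
  have ha : 1 ≤ a := one_le_logb hr0
  have hb : 1 ≤ b := one_le_logb hdiam.le
  have hrD : 0 ≤ r * D := mul_nonneg hr0 hdiam.le
  set z := 2 * (r * D) + 1 with hz
  have hz0 : 0 < z := by linarith
  refine ⟨⌈Real.logb 2 z⌉₊, ⌊∑ i, ξ i * x0 i - s - r * D⌋, fun x hx => ?_, ?_⟩
  · have h1 := abs_le.1 (hdiff x hx)
    have h2 := Int.floor_le (∑ i, ξ i * x0 i - s - r * D)
    have h3 := Int.lt_floor_add_one (∑ i, ξ i * x0 i - s - r * D)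
    refine ⟨by linarith, ?_⟩
    have h4 : z ≤ 2 ^ ⌈Real.logb 2 z⌉₊ := by
      rw [← Real.rpow_natCast, ← Real.logb_le_iff_le_rpow (by norm_num) hz0]
      exact Nat.le_ceil _
    linarith
  · have h1 : Real.logb 2 z ≤ 1 + a + b := by
      have : z ≤ 2 * (2 + r) * (2 + D) := by rw [hz]; nlinarith [hdiam]
      have h2 : Real.logb 2 z ≤ Real.logb 2 (2 * (2 + r) * (2 + D)) :=
        Real.logb_le_logb_of_le (by norm_num) hz0 this
      rw [Real.logb_mul (by positivity) (by positivity), Real.logb_mul (by positivity) (by positivity),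
        Real.logb_self_eq_one (by norm_num)] at h2
      exact h2
    have h2 : (⌈Real.logb 2 z⌉₊ : ℝ) < Real.logb 2 z + 1 :=
      Nat.ceil_lt_add_one (Real.logb_nonneg (by norm_num) (by linarith))
    push_cast
    nlinarith [mul_nonneg (sub_nonneg.2 ha) (sub_nonneg.2 hb)]

def wt {d : ℕ} (ψ : (Fin d → ℝ) → ℂ) (I : ℝ) (p : (Fin d → ℝ) × ℝ) : ℝ :=
  -(Real.pi ^ 2 / 2) * I * (ψ p.1 / (‖ψ p.1‖ : ℂ) * Complex.exp (2 * Real.pi * Complex.I * p.2)).re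

def freqM {d : ℕ} (ψ : (Fin d → ℝ) → ℂ) (I : ℝ) : Measure (Fin d → ℝ) :=
  volume.withDensity (fun ξ => ENNReal.ofReal (‖ψ ξ‖ / I))

def sampM {d : ℕ} (ψ : (Fin d → ℝ) → ℂ) (I : ℝ) : Measure ((Fin d → ℝ) × ℝ) :=
  (freqM ψ I).prod (volume.restrict (Set.Ioc 0 1))

lemma freqM_prob {d : ℕ} {ψ : (Fin d → ℝ) → ℂ} {I : ℝ} (hψ : Integrable ψ)
    (hI : I = ∫ ξ, ‖ψ ξ‖) (hI0 : 0 < I) : IsProbabilityMeasure (freqM ψ I) := by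
  constructor
  unfold freqM
  rw [withDensity_apply _ MeasurableSet.univ, Measure.restrict_univ,
    ← ofReal_integral_eq_lintegral_ofReal (hψ.norm.div_const I)
      (Eventually.of_forall fun ξ => div_nonneg (norm_nonneg _) hI0.le), integral_div, ← hI,
    div_self hI0.ne', ENNReal.ofReal_one]

lemma unif_prob : IsProbabilityMeasure ((volume : Measure ℝ).restrict (Set.Ioc 0 1)) := by
  constructor; simp

lemma wt_bound {d : ℕ} (ψ : (Fin d → ℝ) → ℂ) {I : ℝ} (hI0 : 0 < I) (p : (Fin d → ℝ) × ℝ) :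
    |wt ψ I p| ≤ Real.pi ^ 2 / 2 * I := by
  unfold wt
  rw [abs_mul, abs_mul, abs_neg, abs_of_pos hI0, abs_of_nonneg (by positivity : (0:ℝ) ≤ Real.pi ^ 2 / 2)]
  refine mul_le_of_le_one_right (by positivity) ?_
  refine (Complex.abs_re_le_norm _).trans ?_
  rw [norm_mul, Complex.norm_exp, norm_div]
  simp
  exact div_self_le_one _

lemma wt_measurable {d : ℕ} {ψ : (Fin d → ℝ) → ℂ} (hm : Measurable ψ) (I : ℝ) :
    Measurable (wt ψ I) := by
  unfold wt
  refine Measurable.const_mul ?_ _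
  refine Complex.measurable_re.comp ?_
  refine Measurable.mul ?_ ?_
  · exact (hm.comp measurable_fst).div (Complex.measurable_ofReal.comp (hm.comp measurable_fst).norm)
  · have : Continuous (fun p : (Fin d → ℝ) × ℝ => Complex.exp (2 * Real.pi * Complex.I * p.2)) := by
      fun_prop
    exact this.measurable

def feat {d : ℕ} (ψ : (Fin d → ℝ) → ℂ) (I : ℝ) (p : (Fin d → ℝ) × ℝ) (x : Fin d → ℝ) : ℝ :=
  wt ψ I p * hat (∑ i, p.1 i * x i - p.2)

lemma feat_bound {d : ℕ} (ψ : (Fin d → ℝ) → ℂ) {I : ℝ} (hI0 : 0 < I) (p : (Fin d → ℝ) × ℝ)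
    (x : Fin d → ℝ) : |feat ψ I p x| ≤ Real.pi ^ 2 / 2 * I := by
  unfold feat
  rw [abs_mul, abs_of_nonneg (hat_nonneg _)]
  exact (mul_le_of_le_one_right (abs_nonneg _) (hat_le_one _)).trans (wt_bound ψ hI0 p)

lemma feat_measurable {d : ℕ} {ψ : (Fin d → ℝ) → ℂ} (hm : Measurable ψ) (I : ℝ) :
    Measurable (Function.uncurry (feat ψ I)) := by
  unfold feat
  have h1 : Measurable (fun q : ((Fin d → ℝ) × ℝ) × (Fin d → ℝ) => wt ψ I q.1) :=
    (wt_measurable hm I).comp measurable_fst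
  have h2 : Continuous (fun q : ((Fin d → ℝ) × ℝ) × (Fin d → ℝ) => ∑ i, q.1.1 i * q.2 i - q.1.2) := by
    fun_prop
  exact h1.mul (hat_measurable.comp h2.measurable)

lemma feat_mean {d : ℕ} {ψ : (Fin d → ℝ) → ℂ} {I : ℝ} (hm : Measurable ψ) (hψ : Integrable ψ)
    (hI : I = ∫ ξ, ‖ψ ξ‖) (hI0 : 0 < I) (x : Fin d → ℝ) :
    ∫ p, feat ψ I p x ∂(sampM ψ I) =
      ∫ ξ, (ψ ξ * Complex.exp (2 * (Real.pi : ℂ) * Complex.I * ((∑ i, ξ i * x i : ℝ) : ℂ))).re := by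
  have := freqM_prob hψ hI hI0
  have := unif_prob
  have hint : Integrable (fun p => feat ψ I p x) (sampM ψ I) := by
    unfold sampM
    exact Integrable.of_bound ((feat_measurable hm I).comp
      (measurable_id.prodMk measurable_const)).aestronglyMeasurable (Real.pi ^ 2 / 2 * I)
      (Eventually.of_forall fun p => feat_bound ψ hI0 p x)
  unfold sampM at hint ⊢
  rw [integral_prod _ hint]
  have inner : ∀ ξ : Fin d → ℝ, ∫ s in Set.Ioc (0:ℝ) 1, feat ψ I (ξ, s) x =
      I * (ψ ξ / (‖ψ ξ‖ : ℂ) * Complex.exp (2 * (Real.pi : ℂ) * Complex.I * ((∑ i, ξ i * x i : ℝ) : ℂ))).re := by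
    intro ξ
    set t : ℝ := ∑ i, ξ i * x i with ht
    have hc := hat_conv t
    have hi : IntegrableOn (fun s : ℝ => ψ ξ / (‖ψ ξ‖ : ℂ) * ((hat (t - s) : ℂ) * Complex.exp (2 * Real.pi * Complex.I * s))) (Set.Ioc 0 1) := by
      refine Integrable.const_mul ?_ _
      refine Integrable.of_bound (C := 1) ?_ (Eventually.of_forall fun s => ?_)
      · refine Measurable.aestronglyMeasurable (Measurable.mul ?_ ?_)
        · exact Complex.measurable_ofReal.comp (hat_measurable.comp (measurable_const.sub measurable_id))
        · exact Continuous.measurable (by fun_prop)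
      · rw [norm_mul, Complex.norm_exp, Complex.norm_real, Real.norm_eq_abs, abs_of_nonneg (hat_nonneg _)]
        simp [hat_le_one]
    have e1 : ∀ s : ℝ, feat ψ I (ξ, s) x = (-(Real.pi ^ 2 / 2) * I) *
        (ψ ξ / (‖ψ ξ‖ : ℂ) * ((hat (t - s) : ℂ) * Complex.exp (2 * Real.pi * Complex.I * s))).re := by
      intro s
      simp only [feat, wt]
      rw [← ht, mul_left_comm _ (hat (t - s) : ℂ), Complex.re_ofReal_mul]
      ring
    simp only [e1]
    rw [integral_const_mul]
    have h5 := integral_re hi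
    simp only [RCLike.re_to_complex] at h5
    rw [h5, integral_const_mul, ← intervalIntegral.integral_of_le zero_le_one, hc]
    rw [mul_left_comm, show (-(2 / (Real.pi:ℂ) ^ 2)) = ((-(2 / Real.pi ^ 2) : ℝ) : ℂ) by push_cast; ring,
      Complex.re_ofReal_mul]
    have := Real.pi_ne_zero
    field_simp
  simp only [inner]
  unfold freqM
  rw [integral_withDensity_eq_integral_toReal_smul (by fun_prop)
    (Eventually.of_forall fun ξ => ENNReal.ofReal_lt_top)]
  congr 1; ext ξ
  rw [ENNReal.toReal_ofReal (div_nonneg (norm_nonneg _) hI0.le), smul_eq_mul, ← mul_assoc,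
    div_mul_cancel₀ _ hI0.ne', ← Complex.re_ofReal_mul, ← mul_assoc]
  by_cases h0 : ψ ξ = 0
  · simp [h0]
  · rw [mul_div_cancel₀]
    simpa using h0

lemma cost_integrable {d : ℕ} {ψ : (Fin d → ℝ) → ℂ} {I : ℝ} (hm : Measurable ψ) (hψ : Integrable ψ)
    (hI : I = ∫ ξ, ‖ψ ξ‖) (hI0 : 0 < I)
    (hlog : Integrable (fun ξ => Real.logb 2 (2 + l1 ξ) * ‖ψ ξ‖)) :
    Integrable (fun p : (Fin d → ℝ) × ℝ => Real.logb 2 (2 + l1 p.1)) (sampM ψ I) ∧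
    ∫ p, Real.logb 2 (2 + l1 p.1) ∂(sampM ψ I) =
      (∫ ξ, Real.logb 2 (2 + l1 ξ) * ‖ψ ξ‖) / I := by
  have := freqM_prob hψ hI hI0
  have := unif_prob
  have h1 : Integrable (fun ξ : Fin d → ℝ => Real.logb 2 (2 + l1 ξ)) (freqM ψ I) := by
    unfold freqM
    rw [integrable_withDensity_iff_integrable_smul' (by fun_prop)
      (Eventually.of_forall fun ξ => ENNReal.ofReal_lt_top)]
    refine (hlog.div_const I).congr (Eventually.of_forall fun ξ => ?_)
    simp only
    rw [ENNReal.toReal_ofReal (div_nonneg (norm_nonneg _) hI0.le), smul_eq_mul]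
    ring
  unfold sampM
  refine ⟨h1.comp_fst _, ?_⟩
  rw [integral_fun_fst (fun ξ : Fin d → ℝ => Real.logb 2 (2 + l1 ξ))]
  simp only [probReal_univ, one_smul]
  unfold freqM
  rw [integral_withDensity_eq_integral_toReal_smul (by fun_prop)
    (Eventually.of_forall fun ξ => ENNReal.ofReal_lt_top), ← integral_div]
  congr 1; ext ξ
  rw [ENNReal.toReal_ofReal (div_nonneg (norm_nonneg _) hI0.le), smul_eq_mul]
  ring

set_option maxHeartbeats 1600000 in
/-- If `f : ℝ^d → ℝ` has `f̂ ∈ L¹`, `‖f‖_{B^log} < ∞` and `‖f‖_{B⁰} > 0`,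
then for every `m ≥ 1` and every compact `Ω ⊂ ℝ^d` with `diam(Ω) > 0` there is a ReLU
network `F` of width `d+4` and depth at most `6 C₁(Ω) m ‖f‖_{B^log}/‖f‖_{B⁰}`, where
`C₁(Ω) = log₂(2+diam Ω)`, with `‖f - F‖_{L²(Ω)} ≤ (2π²/√m)|Ω|^{1/2}‖f‖_{B⁰}`
(stated as the equivalent squared bound). -/
theorem L2_approx_general (d : ℕ) (f : (Fin d → ℝ) → ℝ)
    (hf1 : Integrable (fhatR f))
    (hflog : Integrable (fun ξ => Real.logb 2 (2 + l1 ξ) * ‖fhatR f ξ‖))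
    (hB0 : 0 < B0 (fhatR f))
    (m : ℕ) (hm : 0 < m)
    (Ω : Set (Fin d → ℝ)) (hΩc : IsCompact Ω) (hdiam : 0 < eucDiam Ω) :
    ∃ (L : ℕ) (F : (Fin d → ℝ) → ℝ),
      IsReLUNet d (d + 4) L F ∧
      (L : ℝ) ≤ 6 * Real.logb 2 (2 + eucDiam Ω) * m * logBarron (fhatR f) / B0 (fhatR f) ∧
      (∫⁻ x in Ω, ENNReal.ofReal ((f x - F x) ^ 2)) ≤
        ENNReal.ofReal ((2 * Real.pi ^ 2 / Real.sqrt m *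
          Real.sqrt ((volume Ω).toReal) * B0 (fhatR f)) ^ 2) := by
  have hfi := aux_f_integrable f hB0
  have hinv := aux_inversion f hfi hf1
  set I : ℝ := ∫ ξ, ‖fhatR f ξ‖ with hIdef
  have hB : B0 (fhatR f) = 2 * I := rfl
  have hI0 : 0 < I := by rw [hB] at hB0; linarith
  obtain ⟨ψ, hψs, hψe⟩ := hf1.1
  have hψm : Measurable ψ := hψs.measurable
  have hψ : Integrable ψ := hf1.congr hψe
  have hI : I = ∫ ξ, ‖ψ ξ‖ := integral_congr_ae (hψe.mono fun ξ h => by simp only [h])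
  have hle : (fun ξ => Real.logb 2 (2 + l1 ξ) * ‖fhatR f ξ‖) =ᵐ[volume]
      (fun ξ => Real.logb 2 (2 + l1 ξ) * ‖ψ ξ‖) := hψe.mono fun ξ h => by simp only [h]
  have hlog : Integrable (fun ξ => Real.logb 2 (2 + l1 ξ) * ‖ψ ξ‖) := hflog.congr hle
  have hLB : logBarron (fhatR f) = ∫ ξ, Real.logb 2 (2 + l1 ξ) * ‖ψ ξ‖ := integral_congr_ae hle
  obtain ⟨hci, hce⟩ := cost_integrable hψm hψ hI hI0 hlog
  rw [← hLB] at hce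
  set LB := logBarron (fhatR f) with hLBdef
  have hLBI : I ≤ LB := by
    rw [hI, hLB]
    refine integral_mono hψ.norm hlog fun ξ => ?_
    have := one_le_logb (r := l1 ξ) (Finset.sum_nonneg fun i _ => abs_nonneg _)
    exact le_mul_of_one_le_left (norm_nonneg _) this
  set b := Real.logb 2 (2 + eucDiam Ω) with hb
  have hb1 : 1 ≤ b := one_le_logb hdiam.le
  set Q := 6 * b * (LB / I) with hQ
  have hLBI1 : 1 ≤ LB / I := (one_le_div hI0).2 hLBI
  have hQ6 : 6 ≤ Q := by rw [hQ]; nlinarith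
  have hdepth : 6 * b * m * LB / B0 (fhatR f) = m * Q / 2 := by
    rw [hB, hQ]; field_simp
  rw [hdepth, hB]
  have hPp : IsProbabilityMeasure (sampM ψ I) := by
    have := freqM_prob hψ hI hI0
    have := unif_prob
    unfold sampM; infer_instance
  set A := Real.pi ^ 2 / 2 * I with hA
  have hA0 : 0 < A := by positivity
  set g := feat ψ I with hg
  have hgm : Measurable (Function.uncurry g) := feat_measurable hψm I
  have hgb : ∀ p x, |g p x| ≤ A := feat_bound ψ hI0
  set ft : (Fin d → ℝ) → ℝ := fun x => ∫ p, g p x ∂(sampM ψ I) with hft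
  have hftm : Measurable ft := by
    have : StronglyMeasurable ft := by
      apply StronglyMeasurable.integral_prod_left
      exact hgm.stronglyMeasurable
    exact this.measurable
  have hftb : ∀ x, |ft x| ≤ A := by
    intro x
    have := norm_integral_le_of_norm_le_const (μ := sampM ψ I) (f := fun p => g p x) (C := A)
      (Eventually.of_forall fun p => hgb p x)
    simpa using this
  have hfft : ∀ᵐ x, f x = ft x := by
    filter_upwards [hinv] with x hx
    rw [hx, hft]
    simp only [hg]
    rw [feat_mean hψm hψ hI hI0 x]
    exact integral_congr_ae (hψe.mono fun ξ h => by simp only [h])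
  have hΩm : MeasurableSet Ω := hΩc.measurableSet
  have hΩf : IsFiniteMeasure (volume.restrict Ω) :=
    ⟨by rw [Measure.restrict_apply_univ]; exact hΩc.measure_lt_top⟩
  set vol := (volume Ω).toReal with hvol
  have hvol0 : 0 ≤ vol := ENNReal.toReal_nonneg
  have hvolr : (volume.restrict Ω).real Set.univ = vol := by
    simp [Measure.real, hvol]
  have hm0 : (0 : ℝ) < m := by exact_mod_cast hm
  have htarget : (2 * Real.pi ^ 2 / Real.sqrt m * Real.sqrt vol * (2 * I)) ^ 2 =
      64 * (A ^ 2 * vol) / m := by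
    rw [mul_pow, mul_pow, div_pow, Real.sq_sqrt hm0.le, Real.sq_sqrt hvol0, hA]
    ring
  rw [htarget]
  -- general transfer of the error
  have key : ∀ (F G : (Fin d → ℝ) → ℝ) (R : ℝ), Measurable G → (∃ M, ∀ x, |G x| ≤ M) →
      (∀ x ∈ Ω, F x = G x) → ∫ x in Ω, (ft x - G x) ^ 2 ≤ R →
      ∫⁻ x in Ω, ENNReal.ofReal ((f x - F x) ^ 2) ≤ ENNReal.ofReal R := by
    intro F G R hG hM hFG hR
    obtain ⟨M, hM⟩ := hM
    have e : ∫⁻ x in Ω, ENNReal.ofReal ((f x - F x) ^ 2) =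
        ∫⁻ x in Ω, ENNReal.ofReal ((ft x - G x) ^ 2) := by
      refine lintegral_congr_ae ?_
      filter_upwards [ae_restrict_of_ae hfft, ae_restrict_mem hΩm] with x h1 h2
      rw [h1, hFG x h2]
    have hi : Integrable (fun x => (ft x - G x) ^ 2) (volume.restrict Ω) := by
      refine Integrable.of_bound ((hftm.sub hG).pow_const 2).aestronglyMeasurable ((A + M) ^ 2)
        (Eventually.of_forall fun x => ?_)
      rw [Real.norm_eq_abs, abs_pow]
      exact pow_le_pow_left₀ (abs_nonneg _) ((abs_sub _ _).trans (add_le_add (hftb x) (hM x))) 2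
    rw [e, ← ofReal_integral_eq_lintegral_ofReal hi (Eventually.of_forall fun x => sq_nonneg _)]
    exact ENNReal.ofReal_le_ofReal hR
  by_cases hcase : m ≤ 16 ∨ vol = 0
  · refine ⟨0, fun _ => 0, ⟨0, 0, 0, 0, 0, fun x => by simp⟩, ?_, ?_⟩
    · have : 0 ≤ m * Q / 2 := by positivity
      simpa using this
    · refine key _ (fun _ => 0) _ measurable_const ⟨0, by simp⟩ (fun _ _ => rfl) ?_
      have h1 : ∫ x in Ω, (ft x - 0) ^ 2 ≤ A ^ 2 * vol := by
        have h2 := norm_integral_le_of_norm_le_const (μ := volume.restrict Ω)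
          (f := fun x => (ft x - 0) ^ 2) (C := A ^ 2) (Eventually.of_forall fun x => by
            rw [Real.norm_eq_abs, abs_pow, sub_zero]
            exact pow_le_pow_left₀ (abs_nonneg _) (hftb x) 2)
        rw [hvolr] at h2
        exact (le_abs_self _).trans h2
      refine h1.trans ?_
      rcases hcase with h | h
      · rw [le_div_iff₀ hm0]
        have : (m : ℝ) ≤ 16 := by exact_mod_cast h
        nlinarith [mul_nonneg (sq_nonneg A) hvol0]
      · rw [h]; simp
  push Not at hcase
  obtain ⟨hm16, hvne⟩ := hcase
  have hvpos : 0 < vol := lt_of_le_of_ne hvol0 (Ne.symm hvne)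
  set V := A ^ 2 * vol with hV
  have hVpos : 0 < V := by positivity
  obtain ⟨n, hn⟩ : ∃ n : ℕ, n = m / 8 := ⟨_, rfl⟩
  have hn1 : 8 * n ≤ m := by omega
  have hn2 : m ≤ 12 * n := by omega
  have hn1' : 8 * (n : ℝ) ≤ m := by exact_mod_cast hn1
  have hn2' : (m : ℝ) ≤ 12 * n := by exact_mod_cast hn2
  have hn0 : (0 : ℝ) < n := by linarith
  have hm17 : (17 : ℝ) ≤ m := by exact_mod_cast hm16
  have hQpos : 0 < Q := by linarith
  obtain ⟨θ, hθ⟩ := maurey (sampM ψ I) (volume.restrict Ω) g hgm A hgb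
    (fun p => V / Q * (6 * b) * Real.logb 2 (2 + l1 p.1)) (hci.const_mul _) n
  rw [hvolr, integral_const_mul, hce, ← Finset.mul_sum] at hθ
  have hrhs : V / Q * (6 * b) * (LB / I) = V := by
    rw [mul_assoc, ← hQ, div_mul_cancel₀ _ hQpos.ne']
  rw [hrhs, ← hV] at hθ
  have hlogn : ∀ i, 0 ≤ Real.logb 2 (2 + l1 (θ i).1) := fun i =>
    zero_le_one.trans (one_le_logb (Finset.sum_nonneg fun i _ => abs_nonneg _))
  have hsumc : 0 ≤ ∑ i, Real.logb 2 (2 + l1 (θ i).1) := Finset.sum_nonneg fun i _ => hlogn i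
  have hE0 : 0 ≤ ∫ x in Ω, (∑ i, (g (θ i) x - ft x)) ^ 2 := integral_nonneg fun x => sq_nonneg _
  have hE : ∫ x in Ω, (∑ i, (g (θ i) x - ft x)) ^ 2 ≤ 2 * n * V := by
    have : 0 ≤ V / Q * (6 * b) * ∑ i, Real.logb 2 (2 + l1 (θ i).1) := by positivity
    have h3 : (n : ℝ) * (V + V) = 2 * n * V := by ring
    rw [← h3]
    refine le_trans ?_ hθ
    exact le_add_of_nonneg_right this
  have hC : 6 * b * ∑ i, Real.logb 2 (2 + l1 (θ i).1) ≤ 2 * n * Q := by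
    have h3 : V / Q * (6 * b) * ∑ i, Real.logb 2 (2 + l1 (θ i).1) ≤ n * (V + V) := by
      refine le_trans ?_ hθ
      exact le_add_of_nonneg_left hE0
    have h4 : V / Q * (6 * b * ∑ i, Real.logb 2 (2 + l1 (θ i).1)) ≤ V / Q * (2 * n * Q) := by
      calc _ = V / Q * (6 * b) * ∑ i, Real.logb 2 (2 + l1 (θ i).1) := by ring
        _ ≤ _ := h3
        _ = _ := by field_simp; ring
    exact le_of_mul_le_mul_left h4 (by positivity)
  obtain ⟨B, hBB⟩ : ∃ B : ℝ, ∀ x ∈ Ω, ∀ i, 0 ≤ x i + B := by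
    obtain ⟨R, hR⟩ := hΩc.isBounded.exists_norm_le
    refine ⟨R, fun x hx i => ?_⟩
    have h1 := (norm_le_pi_norm x i).trans (hR x hx)
    have := (abs_le.1 (by simpa using h1)).1
    linarith
  choose K c hK hKb using fun i => aux_K (Ω := Ω) hdiam (θ i).1 (θ i).2
  have hgood := Good.sum hBB n (fun i => (θ i).1) (fun i => (θ i).2) (fun i => wt ψ I (θ i)) K c hK
  obtain ⟨F, hF, hFe⟩ := hgood.isReLUNet (1 / n)
  refine ⟨_, F, hF, ?_, ?_⟩
  · have h1 : ((∑ j, (K j + 2) : ℕ) : ℝ) ≤ 6 * b * ∑ i, Real.logb 2 (2 + l1 (θ i).1) := by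
      rw [Nat.cast_sum, Finset.mul_sum]
      exact Finset.sum_le_sum fun i _ => hKb i
    rw [Nat.cast_add]
    have h2 : ((2 : ℕ) : ℝ) = 2 := by norm_num
    rw [h2]
    nlinarith
  · refine key F (fun x => 1 / n * ∑ i, g (θ i) x) _ ?_ ⟨|1 / (n:ℝ)| * ∑ i : Fin n, A, fun x => ?_⟩
      (fun x hx => hFe x hx) ?_
    · exact (Finset.measurable_fun_sum _ fun i _ =>
        hgm.comp (measurable_const.prodMk measurable_id)).const_mul _
    · rw [abs_mul]
      exact mul_le_mul_of_nonneg_left ((Finset.abs_sum_le_sum_abs _ _).trans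
        (Finset.sum_le_sum fun i _ => hgb _ _)) (abs_nonneg _)
    · have e : ∀ x, (ft x - 1 / n * ∑ i, g (θ i) x) ^ 2 =
          1 / (n : ℝ) ^ 2 * (∑ i, (g (θ i) x - ft x)) ^ 2 := by
        intro x
        rw [Finset.sum_sub_distrib, Finset.sum_const, Finset.card_univ, Fintype.card_fin, nsmul_eq_mul]
        field_simp
        ring
      simp only [e]
      rw [integral_const_mul]
      calc 1 / (n : ℝ) ^ 2 * ∫ x in Ω, (∑ i, (g (θ i) x - ft x)) ^ 2
          ≤ 1 / (n : ℝ) ^ 2 * (2 * n * V) := by gcongr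
        _ = 2 * V / n := by field_simp
        _ ≤ 64 * V / m := by
          rw [div_le_div_iff₀ hn0 hm0]
          nlinarith

end
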